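/- arXiv:1805.12383 — 6 statements merged into one kernel-verified Lean document; each statement's English description precedes it below -/
import Mathlib

section
/- Let G be a directed graph on n vertices with m edges, let Γ ∈ ℝ^{n×m} be its incidence matrix, and let c ∈ ℝ^m be a vector of nonnegative edge weights with C = diag(c_{e₁},…,c_{e_m}). Assume that the undirected graph on V whose edges are those e ∈ E with c_e > 0 is connected. Then the reduced Laplacian L̂ (the matrix L = Γ C Γᵀ with its first row and column deleted) is inverse-positive: L̂ is invertible and every entry of L̂⁻¹ is nonnegative. -/
open Matrix

/-- A square real matrix that reflects nonnegativity of vectors is inverse-positive. -/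
theorem Matrix.isUnit_and_inv_nonneg_of_mulVec_nonneg {ι : Type*} [Fintype ι] [DecidableEq ι]
    {A : Matrix ι ι ℝ} (hA : ∀ x, 0 ≤ A *ᵥ x → 0 ≤ x) :
    IsUnit A ∧ ∀ i j, 0 ≤ A⁻¹ i j := by
  have hU : IsUnit A := by
    rw [← Matrix.mulVec_injective_iff_isUnit]
    intro x y hxy
    have hxy : A *ᵥ x = A *ᵥ y := hxy
    refine le_antisymm (sub_nonneg.1 (hA _ ?_)) (sub_nonneg.1 (hA _ ?_)) <;>
      simp [Matrix.mulVec_sub, hxy]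
  refine ⟨hU, fun i j => ?_⟩
  have h := hA (A⁻¹ *ᵥ Pi.single j 1) (by
    rw [Matrix.mulVec_mulVec, Matrix.mul_nonsing_inv _ ((Matrix.isUnit_iff_isUnit_det A).1 hU),
      Matrix.one_mulVec]
    exact Pi.single_nonneg.2 zero_le_one)
  simpa using h i

/-- The Laplacian form pairing `z` with `y` is the weighted sum over the edges of the products of
the differences of `z` and `y`. -/
theorem dotProduct_laplacian_mulVec {V E : Type*} [Fintype V] [DecidableEq V] [Fintype E]
    [DecidableEq E] {src tgt : E → V} (hsl : ∀ e, src e ≠ tgt e) {Γ : Matrix V E ℝ}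
    (hΓ : ∀ v e, Γ v e = if v = tgt e then 1 else if v = src e then -1 else 0)
    (c : E → ℝ) (z y : V → ℝ) :
    z ⬝ᵥ ((Γ * Matrix.diagonal c * Γᵀ) *ᵥ y) =
      ∑ e, c e * ((z (tgt e) - z (src e)) * (y (tgt e) - y (src e))) := by
  have hd (w : V → ℝ) (e : E) : (w ᵥ* Γ) e = w (tgt e) - w (src e) := by
    have hs (v : V) : w v * Γ v e =
        (if v = tgt e then w v else 0) - (if v = src e then w v else 0) := by
      rw [hΓ]
      have := hsl e
      split_ifs <;> simp_all
    simp [Matrix.vecMul, dotProduct, hs]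
  rw [← Matrix.mulVec_mulVec, ← Matrix.mulVec_mulVec, Matrix.dotProduct_mulVec,
    Matrix.mulVec_transpose, dotProduct]
  refine Finset.sum_congr rfl fun e _ => ?_
  rw [Matrix.mulVec_diagonal, hd, hd]
  ring

/-- A function on the vertices of a connected graph that agrees at adjacent vertices is
constant. -/
theorem SimpleGraph.Connected.eq_of_forall_adj {V α : Type*} {G : SimpleGraph V}
    (hG : G.Connected) {f : V → α} (hf : ∀ v w, G.Adj v w → f v = f w) (v w : V) :
    f v = f w := by
  obtain ⟨p⟩ := hG.preconnected v w
  induction p with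
  | nil => rfl
  | cons h _ ih => exact (hf _ _ h).trans ih

/-- The map `a ↦ -a⁻` is firmly nonexpansive. -/
theorem sub_negPart_mul_sub_le (a b : ℝ) : (a⁻ - b⁻) * (a - b) ≤ -(a⁻ - b⁻) ^ 2 := by
  rcases le_total 0 a with ha | ha <;> rcases le_total 0 b with hb | hb <;>
    simp only [negPart_eq_zero.2, negPart_eq_neg.2, ha, hb] <;> nlinarith

/-- For a directed graph on `n+1` vertices with incidence matrix `Γ` and
nonnegative edge weights `c` such that the undirected graph formed by the edges of positive
weight is connected, the reduced Laplacian `L̂` (the weighted Laplacian `L = Γ C Γᵀ` with its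
first row and column deleted) is inverse-positive: `L̂` is invertible and every entry of
`L̂⁻¹` is nonnegative. -/
theorem reduced_laplacian_inverse_positive
    (n m : ℕ) (src tgt : Fin m → Fin (n + 1))
    (hsl : ∀ e, src e ≠ tgt e)
    (hpar : ∀ e e', src e = src e' → tgt e = tgt e' → e = e')
    (Γ : Matrix (Fin (n + 1)) (Fin m) ℝ)
    (hΓ : ∀ v e, Γ v e = if v = tgt e then 1 else if v = src e then -1 else 0)
    (c : Fin m → ℝ) (hc : ∀ e, 0 ≤ c e)
    (hconn : (SimpleGraph.fromRel
        (fun v w => ∃ e, 0 < c e ∧ src e = v ∧ tgt e = w)).Connected) :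
    IsUnit ((Γ * Matrix.diagonal c * Γᵀ).submatrix Fin.succ Fin.succ) ∧
    ∀ i j, 0 ≤ ((Γ * Matrix.diagonal c * Γᵀ).submatrix Fin.succ Fin.succ)⁻¹ i j := by
  refine Matrix.isUnit_and_inv_nonneg_of_mulVec_nonneg fun x hx => ?_
  set L := Γ * Matrix.diagonal c * Γᵀ
  let y : Fin (n + 1) → ℝ := Fin.cons 0 x
  let z : Fin (n + 1) → ℝ := fun v => (y v)⁻
  have hz0 : z 0 = 0 := by simp [z, y]
  have hpair : 0 ≤ z ⬝ᵥ (L *ᵥ y) := by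
    have hL (i : Fin n) : (L *ᵥ y) i.succ = (L.submatrix Fin.succ Fin.succ *ᵥ x) i := by
      simp [Matrix.mulVec, dotProduct, Fin.sum_univ_succ, y]
    rw [dotProduct, Fin.sum_univ_succ, hz0, zero_mul, zero_add]
    exact Finset.sum_nonneg fun i _ => mul_nonneg (negPart_nonneg _) (hL i ▸ hx i)
  rw [dotProduct_laplacian_mulVec hsl hΓ] at hpair
  have hle (e : Fin m) : c e * ((z (tgt e) - z (src e)) * (y (tgt e) - y (src e))) ≤
      -(c e * (z (tgt e) - z (src e)) ^ 2) := by
    rw [← mul_neg]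
    exact mul_le_mul_of_nonneg_left (sub_negPart_mul_sub_le _ _) (hc e)
  have hnonneg (e : Fin m) : 0 ≤ c e * (z (tgt e) - z (src e)) ^ 2 :=
    mul_nonneg (hc e) (sq_nonneg _)
  have hsum : ∑ e, c e * (z (tgt e) - z (src e)) ^ 2 = 0 := by
    refine le_antisymm ?_ (Finset.sum_nonneg fun e _ => hnonneg e)
    have := hpair.trans (Finset.sum_le_sum fun e _ => hle e)
    rwa [Finset.sum_neg_distrib, neg_nonneg] at this
  have hedge (e : Fin m) (he : 0 < c e) : z (tgt e) = z (src e) := by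
    have := (Finset.sum_eq_zero_iff_of_nonneg fun e _ => hnonneg e).1 hsum e (Finset.mem_univ e)
    simpa [he.ne', sub_eq_zero] using this
  have hconst := hconn.eq_of_forall_adj (f := z) fun v w hvw => by
    obtain ⟨-, ⟨e, he, rfl, rfl⟩ | ⟨e, he, rfl, rfl⟩⟩ := (SimpleGraph.fromRel_adj _ _ _).1 hvw
    exacts [(hedge e he).symm, hedge e he]
  intro i
  simpa [z, y] using (hconst i.succ 0).trans hz0
end

section
/- Let G be a directed graph with incidence matrix Γ, and for each edge e let l_e : ℝ_{≥0} → ℝ_{≥0} be a continuous cost function with l_e(ξ) > 0 for all ξ > 0. Let X ∈ ℝ^{m×k} be a feasible multi-commodity flow for demand matrix Y with total flow z. Then X is a Wardrop equilibrium if and only if there exist potential vectors π_j ∈ ℝⁿ for every commodity j = 1,…,k such that for every edge e = (v,w) ∈ E: π_{j,w} − π_{j,v} ≤ l_e(z_e), with equality π_{j,w} − π_{j,v} = l_e(z_e) whenever x_{e,j} > 0. -/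
open Matrix BigOperators

/-- A directed walk from `a` to `b` given by the list of its edges. -/
inductive DirWalk {n m : ℕ} (src tgt : Fin m → Fin n) : Fin n → Fin n → List (Fin m) → Prop
  | nil (v : Fin n) : DirWalk src tgt v v []
  | cons (e : Fin m) {w : Fin n} {p : List (Fin m)} :
      DirWalk src tgt (tgt e) w p → DirWalk src tgt (src e) w (e :: p)

/-- A simple (vertex-repetition-free) directed path from `a` to `b`. -/
def IsSimplePath {n m : ℕ} (src tgt : Fin m → Fin n) (a b : Fin n) (p : List (Fin m)) : Prop :=
  DirWalk src tgt a b p ∧ (a :: p.map tgt).Nodup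

/-- The cost of a path, given the cost of each edge. -/
def pathCost {m : ℕ} (l : Fin m → ℝ) (p : List (Fin m)) : ℝ :=
  (p.map l).sum

/-- A feasible multi-commodity flow `X` is a Wardrop equilibrium: for every commodity `j`
no directed cycle is flow-carrying, and every flow-carrying simple `s_j`-`t_j` path is at
most as long as any other simple `s_j`-`t_j` path (lengths w.r.t. the total flow). -/
def IsWardrop {n m k : ℕ} (src tgt : Fin m → Fin n) (s t : Fin k → Fin n)
    (l : Fin m → ℝ → ℝ) (X : Fin m → Fin k → ℝ) : Prop :=
  (∀ j : Fin k, ¬ ∃ (v : Fin n) (p : List (Fin m)),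
      p ≠ [] ∧ DirWalk src tgt v v p ∧ ∀ e ∈ p, 0 < X e j) ∧
  (∀ (j : Fin k) (P Q : List (Fin m)),
    IsSimplePath src tgt (s j) (t j) P → IsSimplePath src tgt (s j) (t j) Q →
    (∀ e ∈ P, 0 < X e j) →
    pathCost (fun e => l e (∑ j', X e j')) P ≤ pathCost (fun e => l e (∑ j', X e j')) Q)

namespace DirWalk

variable {n m : ℕ} {src tgt : Fin m → Fin n} {a b v : Fin n} {p p' : List (Fin m)}

theorem append (h : DirWalk src tgt a v p) (h' : DirWalk src tgt v b p') :
    DirWalk src tgt a b (p ++ p') := by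
  induction h with
  | nil => exact h'
  | cons e _ ih => exact .cons e (ih h')

theorem single (e : Fin m) : DirWalk src tgt (src e) (tgt e) [e] :=
  .cons e (.nil _)

/-- A walk can be split at any vertex entered by one of its edges. -/
theorem exists_append_of_mem (h : DirWalk src tgt a b p) (hv : v ∈ p.map tgt) :
    ∃ p₁ p₂, p = p₁ ++ p₂ ∧ p₁ ≠ [] ∧ DirWalk src tgt a v p₁ ∧ DirWalk src tgt v b p₂ := by
  induction h with
  | nil => simp at hv
  | @cons e w p h ih =>
    rw [List.map_cons, List.mem_cons] at hv
    rcases hv with rfl | hv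
    · exact ⟨[e], p, rfl, by simp, single e, h⟩
    · obtain ⟨p₁, p₂, rfl, -, h₁, h₂⟩ := ih hv
      exact ⟨e :: p₁, p₂, rfl, by simp, .cons e h₁, h₂⟩

/-- A walk that is not simple contains a closed subwalk. -/
theorem exists_closed_of_not_nodup (h : DirWalk src tgt a b p)
    (hp : ¬ (a :: p.map tgt).Nodup) :
    ∃ v p₁ p₂ p₃, p = p₁ ++ (p₂ ++ p₃) ∧ p₂ ≠ [] ∧ DirWalk src tgt a v p₁ ∧
      DirWalk src tgt v v p₂ ∧ DirWalk src tgt v b p₃ := by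
  induction h with
  | nil => simp at hp
  | @cons e w p h ih =>
    by_cases hv : src e ∈ (e :: p).map tgt
    · obtain ⟨p₁, p₂, hpp, hne, h₁, h₂⟩ := (DirWalk.cons e h).exists_append_of_mem hv
      exact ⟨src e, [], p₁, p₂, hpp, hne, .nil _, h₁, h₂⟩
    · obtain ⟨v, p₁, p₂, p₃, rfl, hne, h₁, h₂, h₃⟩ :=
        ih fun hnd => hp (List.nodup_cons.2 ⟨hv, hnd⟩)
      exact ⟨v, e :: p₁, p₂, p₃, rfl, hne, .cons e h₁, h₂, h₃⟩

/-- A walk whose edges support no directed cycle is a simple path. -/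
theorem isSimplePath_of_acyclic {F : Fin m → Prop}
    (hF : ¬ ∃ v p, p ≠ [] ∧ DirWalk src tgt v v p ∧ ∀ e ∈ p, F e)
    (h : DirWalk src tgt a b p) (hp : ∀ e ∈ p, F e) : IsSimplePath src tgt a b p := by
  refine ⟨h, by_contra fun hnd => ?_⟩
  obtain ⟨v, p₁, p₂, p₃, rfl, hne, -, h₂, -⟩ := h.exists_closed_of_not_nodup hnd
  exact hF ⟨v, p₂, hne, h₂, fun e he => hp e (by simp [he])⟩

end DirWalk

section pathCost

variable {m : ℕ} {c : Fin m → ℝ}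

theorem pathCost_append (c : Fin m → ℝ) (p q : List (Fin m)) :
    pathCost c (p ++ q) = pathCost c p + pathCost c q := by
  simp [pathCost]

theorem pathCost_cons (c : Fin m → ℝ) (e : Fin m) (p : List (Fin m)) :
    pathCost c (e :: p) = c e + pathCost c p := by
  simp [pathCost]

theorem pathCost_nonneg (hc : ∀ e, 0 ≤ c e) (p : List (Fin m)) : 0 ≤ pathCost c p :=
  List.sum_nonneg (by simpa using fun e _ => hc e)

theorem pathCost_pos {p : List (Fin m)} (hp : p ≠ []) (hc : ∀ e ∈ p, 0 < c e) :
    0 < pathCost c p :=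
  List.sum_pos _ (by simpa using hc) (by simpa using hp)

end pathCost

section Potential

variable {n m : ℕ} {src tgt : Fin m → Fin n} {a b : Fin n} {p : List (Fin m)}
  {c : Fin m → ℝ} {π : Fin n → ℝ}

theorem DirWalk.potential_sub_le (hπ : ∀ e, π (tgt e) - π (src e) ≤ c e)
    (h : DirWalk src tgt a b p) : π b - π a ≤ pathCost c p := by
  induction h with
  | nil => simp [pathCost]
  | cons e _ ih =>
    rw [pathCost_cons]
    linarith [hπ e]

theorem DirWalk.potential_sub_eq (h : DirWalk src tgt a b p)
    (hπ : ∀ e ∈ p, π (tgt e) - π (src e) = c e) : π b - π a = pathCost c p := by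
  induction h with
  | nil => simp [pathCost]
  | cons e _ ih =>
    rw [pathCost_cons, ← ih fun e' he' => hπ e' (List.mem_cons_of_mem _ he'),
      ← hπ e List.mem_cons_self]
    ring

/-- For nonnegative costs, every walk can be shortcut to a simple path that is no longer. -/
theorem DirWalk.exists_isSimplePath_le (hc : ∀ e, 0 ≤ c e) (h : DirWalk src tgt a b p) :
    ∃ q, IsSimplePath src tgt a b q ∧ pathCost c q ≤ pathCost c p := by
  induction hn : p.length using Nat.strong_induction_on generalizing p with
  | _ N ih =>
    by_cases hnd : (a :: p.map tgt).Nodup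
    · exact ⟨p, ⟨h, hnd⟩, le_rfl⟩
    · obtain ⟨v, p₁, p₂, p₃, rfl, hne, h₁, -, h₃⟩ := h.exists_closed_of_not_nodup hnd
      have := List.length_pos_of_ne_nil hne
      simp only [List.length_append] at hn
      obtain ⟨q, hq, hle⟩ :=
        ih (p₁ ++ p₃).length (by rw [List.length_append]; omega) (h₁.append h₃) rfl
      refine ⟨q, hq, hle.trans ?_⟩
      simp only [pathCost_append]
      linarith [pathCost_nonneg hc p₂]

end Potential

section Acyclic

variable {n m : ℕ} {src tgt : Fin m → Fin n} {F : Fin m → Prop}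

/-- The endpoints of a nonempty chain of `F`-edges are joined by a nonempty `F`-walk. -/
theorem exists_dirWalk_of_transGen {a b : Fin n}
    (h : Relation.TransGen (fun a b => ∃ e, F e ∧ src e = a ∧ tgt e = b) a b) :
    ∃ p, p ≠ [] ∧ DirWalk src tgt a b p ∧ ∀ e ∈ p, F e := by
  induction h with
  | single h =>
    obtain ⟨e, he, rfl, rfl⟩ := h
    exact ⟨[e], by simp, .single e, by simpa using he⟩
  | tail _ h ih =>
    obtain ⟨p, hne, hp, hF⟩ := ih
    obtain ⟨e, he, rfl, rfl⟩ := h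
    refine ⟨p ++ [e], by simp, hp.append (.single e), fun e' he' => ?_⟩
    rcases List.mem_append.1 he' with h | h
    · exact hF e' h
    · rwa [List.mem_singleton.1 h]

variable (hF : ¬ ∃ v p, p ≠ [] ∧ DirWalk src tgt v v p ∧ ∀ e ∈ p, F e)
include hF

theorem irrefl_transGen_of_acyclic :
    Std.Irrefl (Relation.TransGen fun a b => ∃ e, F e ∧ src e = a ∧ tgt e = b) :=
  ⟨fun v hv => hF ⟨v, exists_dirWalk_of_transGen hv⟩⟩

/-- In an acyclic edge set in which every edge not entering `t` can be continued, every edge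
can be continued to `t`. -/
theorem exists_dirWalk_to_of_acyclic {t : Fin n}
    (hout : ∀ e, F e → tgt e ≠ t → ∃ e', F e' ∧ src e' = tgt e) (e : Fin m) (he : F e) :
    ∃ p, DirWalk src tgt (tgt e) t p ∧ ∀ e ∈ p, F e := by
  have := irrefl_transGen_of_acyclic hF
  have hwf := Finite.wellFounded_of_trans_of_irrefl
    (Function.swap (Relation.TransGen fun a b => ∃ e, F e ∧ src e = a ∧ tgt e = b))
  induction hv : tgt e using hwf.induction generalizing e with
  | _ v ih =>
    subst hv
    by_cases ht : tgt e = t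
    · exact ⟨[], ht ▸ .nil _, by simp⟩
    · obtain ⟨e', he', hs⟩ := hout e he ht
      obtain ⟨p, hp, hpF⟩ := ih (tgt e') (.single ⟨e', he', hs, rfl⟩) e' he' rfl
      exact ⟨e' :: p, hs ▸ .cons e' hp, by simpa using ⟨he', hpF⟩⟩

/-- In an acyclic edge set in which every edge not leaving `s` has a predecessor, every edge
can be reached from `s`. -/
theorem exists_dirWalk_from_of_acyclic {s : Fin n}
    (hin : ∀ e, F e → src e ≠ s → ∃ e', F e' ∧ tgt e' = src e) (e : Fin m) (he : F e) :
    ∃ p, DirWalk src tgt s (src e) p ∧ ∀ e ∈ p, F e := by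
  have := irrefl_transGen_of_acyclic hF
  have hwf := Finite.wellFounded_of_trans_of_irrefl
    (Relation.TransGen fun a b => ∃ e, F e ∧ src e = a ∧ tgt e = b)
  induction hv : src e using hwf.induction generalizing e with
  | _ v ih =>
    subst hv
    by_cases hs : src e = s
    · exact ⟨[], hs ▸ .nil _, by simp⟩
    · obtain ⟨e', he', ht⟩ := hin e he hs
      obtain ⟨p, hp, hpF⟩ := ih (src e') (.single ⟨e', he', rfl, ht⟩) e' he' rfl
      refine ⟨p ++ [e'], ht ▸ hp.append (.single e'), fun e'' h => ?_⟩
      rcases List.mem_append.1 h with h | h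
      · exact hpF e'' h
      · rwa [List.mem_singleton.1 h]

/-- If the edges in `F` form no cycle, each of them extends to an `s`-`t` walk in `F`, and all
simple `s`-`t` paths in `F` are shortest, then there is a potential that is tight on `F`, namely
the distance from `s` truncated at the distance from `s` to `t`. -/
theorem exists_potential {s t : Fin n} {c : Fin m → ℝ} (hc : ∀ e, 0 ≤ c e)
    (hout : ∀ e, F e → tgt e ≠ t → ∃ e', F e' ∧ src e' = tgt e)
    (hin : ∀ e, F e → src e ≠ s → ∃ e', F e' ∧ tgt e' = src e)
    (hopt : ∀ P Q, IsSimplePath src tgt s t P → IsSimplePath src tgt s t Q →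
      (∀ e ∈ P, F e) → pathCost c P ≤ pathCost c Q) :
    ∃ π : Fin n → ℝ, ∀ e, π (tgt e) - π (src e) ≤ c e ∧
      (F e → π (tgt e) - π (src e) = c e) := by
  by_cases h₀ : ∃ P, DirWalk src tgt s t P ∧ ∀ e ∈ P, F e
  swap
  · refine ⟨0, fun e => ⟨by simpa using hc e, fun he => ?_⟩⟩
    obtain ⟨A, hA, hAF⟩ := exists_dirWalk_from_of_acyclic hF hin e he
    obtain ⟨B, hB, hBF⟩ := exists_dirWalk_to_of_acyclic hF hout e he
    refine (h₀ ⟨A ++ e :: B, hA.append (.cons e hB), fun e' h => ?_⟩).elim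
    rcases List.mem_append.1 h with h | h
    · exact hAF e' h
    · rcases List.mem_cons.1 h with rfl | h
      · exact he
      · exact hBF e' h
  obtain ⟨P₀, hP₀, hP₀F⟩ := h₀
  have hwalk : ∀ P Q, DirWalk src tgt s t P → DirWalk src tgt s t Q → (∀ e ∈ P, F e) →
      pathCost c P ≤ pathCost c Q := fun P Q hP hQ hPF => by
    obtain ⟨Q', hQ', hle⟩ := hQ.exists_isSimplePath_le hc
    exact (hopt P Q' (hP.isSimplePath_of_acyclic hF hPF) hQ' hPF).trans hle
  let S : Fin n → Set ℝ := fun v =>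
    insert (pathCost c P₀) {x | ∃ p, DirWalk src tgt s v p ∧ pathCost c p = x}
  have hbdd : ∀ v, BddBelow (S v) := fun v => by
    refine ⟨0, ?_⟩
    rintro x (rfl | ⟨p, -, rfl⟩) <;> exact pathCost_nonneg hc _
  have hne : ∀ v, (S v).Nonempty := fun v => ⟨_, Or.inl rfl⟩
  have hle : ∀ e, sInf (S (tgt e)) - sInf (S (src e)) ≤ c e := fun e => by
    rw [sub_le_comm]
    refine le_csInf (hne _) ?_
    rintro x (rfl | ⟨p, hp, rfl⟩)
    · linarith [hc e, csInf_le (hbdd (tgt e)) (Or.inl rfl)]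
    · have := csInf_le (hbdd (tgt e)) (Or.inr ⟨p ++ [e], hp.append (.single e), rfl⟩)
      rw [pathCost_append, pathCost_cons] at this
      simp only [pathCost, List.map_nil, List.sum_nil, add_zero] at this ⊢
      linarith
  refine ⟨fun v => sInf (S v), fun e => ⟨hle e, fun he => (hle e).antisymm ?_⟩⟩
  obtain ⟨A, hA, hAF⟩ := exists_dirWalk_from_of_acyclic hF hin e he
  obtain ⟨B, hB, hBF⟩ := exists_dirWalk_to_of_acyclic hF hout e he
  have hP : DirWalk src tgt s t (A ++ e :: B) := hA.append (.cons e hB)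
  have hPF : ∀ e' ∈ A ++ e :: B, F e' := fun e' h => by
    rcases List.mem_append.1 h with h | h
    · exact hAF e' h
    · rcases List.mem_cons.1 h with rfl | h
      · exact he
      · exact hBF e' h
  have hcost : pathCost c (A ++ e :: B) = pathCost c A + (c e + pathCost c B) := by
    rw [pathCost_append, pathCost_cons]
  have h₁ : sInf (S (src e)) ≤ pathCost c A := csInf_le (hbdd _) (Or.inr ⟨A, hA, rfl⟩)
  have h₂ : pathCost c A + c e ≤ sInf (S (tgt e)) := by
    refine le_csInf (hne _) ?_
    rintro x (rfl | ⟨p, hp, rfl⟩)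
    · linarith [hwalk _ _ hP hP₀ hPF, pathCost_nonneg hc B]
    · have := hwalk _ _ hP (hp.append hB) hPF
      rw [pathCost_append c p B] at this
      linarith
  show c e ≤ sInf (S (tgt e)) - sInf (S (src e))
  linarith

end Acyclic

/-- A term of positive sign in a nonpositive finite sum is compensated by a negative term. -/
theorem exists_neg_of_sum_nonpos {m : ℕ} {f : Fin m → ℝ} (h : ∑ e, f e ≤ 0) {e : Fin m}
    (he : 0 < f e) : ∃ e', f e' < 0 := by
  by_contra! hf
  exact absurd h (not_le.2 (Finset.sum_pos' (fun i _ => hf i) ⟨e, Finset.mem_univ e, he⟩))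

/-- In a directed multi-commodity network with continuous, nonnegative cost
functions that are positive for positive flow, a feasible flow `X` is a Wardrop equilibrium
if and only if there exist potentials `π_j` with `π_{j,w} - π_{j,v} ≤ l_e(z_e)` for all edges
`e = (v,w)`, with equality whenever `x_{e,j} > 0`. -/
theorem wardrop_iff_potentials
    (n m k : ℕ) (src tgt : Fin m → Fin n)
    (hsl : ∀ e, src e ≠ tgt e)
    (hpar : ∀ e e', src e = src e' → tgt e = tgt e' → e = e')
    (Γ : Matrix (Fin n) (Fin m) ℝ)
    (hΓ : ∀ v e, Γ v e = if v = tgt e then 1 else if v = src e then -1 else 0)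
    (l : Fin m → ℝ → ℝ)
    (hcont : ∀ e, ContinuousOn (l e) (Set.Ici 0))
    (hnn : ∀ e ξ, 0 ≤ ξ → 0 ≤ l e ξ)
    (hpos : ∀ e ξ, 0 < ξ → 0 < l e ξ)
    (s t : Fin k → Fin n) (q : Fin k → ℝ) (hq : ∀ j, 0 ≤ q j)
    (Y : Matrix (Fin n) (Fin k) ℝ)
    (hY : ∀ v j, Y v j = (if v = t j then q j else 0) - (if v = s j then q j else 0))
    (X : Matrix (Fin m) (Fin k) ℝ)
    (hXnn : ∀ e j, 0 ≤ X e j)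
    (hfeas : Γ * X = Y) :
    IsWardrop src tgt s t l (fun e j => X e j) ↔
      ∃ π : Fin k → Fin n → ℝ, ∀ (j : Fin k) (e : Fin m),
        π j (tgt e) - π j (src e) ≤ l e (∑ j', X e j') ∧
        (0 < X e j → π j (tgt e) - π j (src e) = l e (∑ j', X e j')) := by
  have hz : ∀ e, 0 ≤ ∑ j', X e j' := fun e => Finset.sum_nonneg fun j _ => hXnn e j
  have hzpos : ∀ e j, 0 < X e j → 0 < l e (∑ j', X e j') := fun e j h =>
    hpos e _ (Finset.sum_pos' (fun j' _ => hXnn e j') ⟨j, Finset.mem_univ j, h⟩)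
  have hbal : ∀ v j, ∑ e, Γ v e * X e j = Y v j := fun v j => by
    rw [← hfeas, Matrix.mul_apply]
  constructor
  · rintro ⟨hcyc, hopt⟩
    refine Classical.skolem.1 fun j =>
      exists_potential (F := fun e => 0 < X e j) (hcyc j) (fun e => hnn e _ (hz e)) ?_ ?_
        (hopt j)
    · intro e he ht
      have hsum : ∑ e', Γ (tgt e) e' * X e' j ≤ 0 := by
        rw [hbal, hY, if_neg ht]
        split_ifs <;> simp [hq j]
      obtain ⟨e', he'⟩ := exists_neg_of_sum_nonpos hsum (e := e) (by simpa [hΓ] using he)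
      have hX := hXnn e' j
      rw [hΓ] at he'
      split_ifs at he' with h₁ h₂
      · linarith
      · exact ⟨e', by linarith, h₂.symm⟩
      · linarith
    · intro e he hs
      have hsum : ∑ e', -(Γ (src e) e' * X e' j) ≤ 0 := by
        rw [Finset.sum_neg_distrib, hbal, hY, if_neg hs]
        split_ifs <;> simp [hq j]
      obtain ⟨e', he'⟩ := exists_neg_of_sum_nonpos hsum (e := e)
        (by simpa [hΓ, hsl e] using he)
      have hX := hXnn e' j
      rw [hΓ] at he'
      split_ifs at he' with h₁ h₂
      · exact ⟨e', by linarith, h₁.symm⟩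
      · linarith
      · linarith
  · rintro ⟨π, hπ⟩
    refine ⟨?_, ?_⟩
    · rintro j ⟨v, p, hne, hp, hX⟩
      have h := hp.potential_sub_eq fun e he => (hπ j e).2 (hX e he)
      have := pathCost_pos (c := fun e => l e (∑ j', X e j')) hne
        fun e he => hzpos e j (hX e he)
      linarith
    · intro j P Q hP hQ hX
      rw [← hP.1.potential_sub_eq fun e he => (hπ j e).2 (hX e he)]
      exact hQ.1.potential_sub_le fun e => (hπ j e).1
end

section
/- Let G be a directed graph with incidence matrix Γ, interpreted as an undirected network (negative flow on an edge travels against its orientation), and for each edge e let l_e : ℝ → ℝ be a continuous cost function with l_e(ξ) > 0 for all ξ > 0 and l_e(ξ) < 0 for all ξ < 0. Let x ∈ ℝ^m be a feasible single-commodity flow for source s, sink t and demand q ≥ 0. Then x is a Wardrop equilibrium if and only if there exists a potential vector π ∈ ℝⁿ such that π_w − π_v = l_e(x_e) for every edge e = (v,w) ∈ E. -/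
open Matrix BigOperators

/-- An undirected walk from `a` to `b`, given by the list of its steps; a step `(e, true)`
traverses edge `e` in its orientation, a step `(e, false)` traverses it backwards. -/
inductive UWalk {n m : ℕ} (src tgt : Fin m → Fin n) :
    Fin n → Fin n → List (Fin m × Bool) → Prop
  | nil (v : Fin n) : UWalk src tgt v v []
  | consF (e : Fin m) {w : Fin n} {p : List (Fin m × Bool)} :
      UWalk src tgt (tgt e) w p → UWalk src tgt (src e) w ((e, true) :: p)
  | consB (e : Fin m) {w : Fin n} {p : List (Fin m × Bool)} :
      UWalk src tgt (src e) w p → UWalk src tgt (tgt e) w ((e, false) :: p)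

/-- The vertex a step of an undirected walk leads to. -/
def stepHead {n m : ℕ} (src tgt : Fin m → Fin n) (st : Fin m × Bool) : Fin n :=
  if st.2 then tgt st.1 else src st.1

/-- A simple (vertex-repetition-free) undirected path from `a` to `b`. -/
def IsSimpleUPath {n m : ℕ} (src tgt : Fin m → Fin n) (a b : Fin n)
    (p : List (Fin m × Bool)) : Prop :=
  UWalk src tgt a b p ∧ (a :: p.map (stepHead src tgt)).Nodup

/-- The cost `l_P = Σ_{e ∈ P} l_e χ_{P,e}` of an undirected path, given edge costs `l`. -/
def upathCost {m : ℕ} (l : Fin m → ℝ) (p : List (Fin m × Bool)) : ℝ :=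
  (p.map (fun st => if st.2 then l st.1 else -(l st.1))).sum

/-- An undirected walk is flow-carrying for `x` if `x_e χ_{P,e} > 0` on each of its steps. -/
def UFlowCarrying {m : ℕ} (x : Fin m → ℝ) (p : List (Fin m × Bool)) : Prop :=
  ∀ st ∈ p, if st.2 then 0 < x st.1 else x st.1 < 0

/-- A feasible undirected flow `x` is a Wardrop equilibrium: no undirected cycle is
flow-carrying and every flow-carrying simple `s`-`t` path is at most as long as any
other simple `s`-`t` path. -/
def IsUWardrop {n m : ℕ} (src tgt : Fin m → Fin n) (s t : Fin n)
    (l : Fin m → ℝ → ℝ) (x : Fin m → ℝ) : Prop :=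
  (¬ ∃ (v : Fin n) (p : List (Fin m × Bool)),
      p ≠ [] ∧ UWalk src tgt v v p ∧ UFlowCarrying x p) ∧
  (∀ P Q, IsSimpleUPath src tgt s t P → IsSimpleUPath src tgt s t Q →
    UFlowCarrying x P →
    upathCost (fun e => l e (x e)) P ≤ upathCost (fun e => l e (x e)) Q)

section UWalk

variable {n m : ℕ} {src tgt : Fin m → Fin n}

/-- The vertex a step of an undirected walk starts from. -/
def stepTail (src tgt : Fin m → Fin n) (st : Fin m × Bool) : Fin n :=
  if st.2 then src st.1 else tgt st.1

/-- The value of an edge function along a step, negated if the step is backwards. -/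
def stepVal (f : Fin m → ℝ) (st : Fin m × Bool) : ℝ :=
  if st.2 then f st.1 else -(f st.1)

theorem upathCost_nil (f : Fin m → ℝ) : upathCost f [] = 0 := rfl

theorem upathCost_cons (f : Fin m → ℝ) (st : Fin m × Bool) (p : List (Fin m × Bool)) :
    upathCost f (st :: p) = stepVal f st + upathCost f p := by
  simp [upathCost, stepVal]

theorem upathCost_append (f : Fin m → ℝ) (p q : List (Fin m × Bool)) :
    upathCost f (p ++ q) = upathCost f p + upathCost f q := by
  simp [upathCost]

theorem uFlowCarrying_iff {x : Fin m → ℝ} {p : List (Fin m × Bool)} :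
    UFlowCarrying x p ↔ ∀ st ∈ p, 0 < stepVal x st := by
  refine forall₂_congr fun st _ => ?_
  by_cases h : st.2 <;> simp [stepVal, h]

theorem UWalk.cons (st : Fin m × Bool) {w : Fin n} {p : List (Fin m × Bool)}
    (h : UWalk src tgt (stepHead src tgt st) w p) :
    UWalk src tgt (stepTail src tgt st) w (st :: p) := by
  obtain ⟨e, b⟩ := st
  cases b
  · exact UWalk.consB e h
  · exact UWalk.consF e h

theorem uWalk_nil_iff {a b : Fin n} : UWalk src tgt a b [] ↔ a = b := by
  constructor
  · intro h
    cases h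
    rfl
  · rintro rfl
    exact UWalk.nil a

theorem uWalk_cons_iff {a b : Fin n} {st : Fin m × Bool} {p : List (Fin m × Bool)} :
    UWalk src tgt a b (st :: p) ↔
      a = stepTail src tgt st ∧ UWalk src tgt (stepHead src tgt st) b p := by
  constructor
  · intro h
    cases h with
    | consF e h => exact ⟨rfl, h⟩
    | consB e h => exact ⟨rfl, h⟩
  · rintro ⟨rfl, h⟩
    exact h.cons st

theorem UWalk.append {a b c : Fin n} {p q : List (Fin m × Bool)}
    (hp : UWalk src tgt a b p) (hq : UWalk src tgt b c q) : UWalk src tgt a c (p ++ q) := by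
  induction p generalizing a with
  | nil => rwa [uWalk_nil_iff.1 hp]
  | cons st p ih =>
    obtain ⟨rfl, h⟩ := uWalk_cons_iff.1 hp
    exact (ih h).cons st

theorem UWalk.single (st : Fin m × Bool) :
    UWalk src tgt (stepTail src tgt st) (stepHead src tgt st) [st] :=
  (UWalk.nil _).cons st

/-- A walk can be split at any vertex one of its steps leads to. -/
theorem UWalk.exists_split {a b v : Fin n} {p : List (Fin m × Bool)}
    (hp : UWalk src tgt a b p) (hv : v ∈ p.map (stepHead src tgt)) :
    ∃ p₁ p₂, p = p₁ ++ p₂ ∧ p₁ ≠ [] ∧ UWalk src tgt a v p₁ ∧ UWalk src tgt v b p₂ := by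
  induction p generalizing a with
  | nil => simp at hv
  | cons st p ih =>
    obtain ⟨rfl, h⟩ := uWalk_cons_iff.1 hp
    rw [List.map_cons, List.mem_cons] at hv
    rcases hv with rfl | hv
    · exact ⟨[st], p, rfl, by simp, UWalk.single st, h⟩
    · obtain ⟨p₁, p₂, rfl, -, h₁, h₂⟩ := ih h hv
      exact ⟨st :: p₁, p₂, rfl, by simp, h₁.cons st, h₂⟩

/-- Every walk contains a simple path with the same endpoints. -/
theorem UWalk.exists_simple {a b : Fin n} {p : List (Fin m × Bool)}
    (hp : UWalk src tgt a b p) :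
    ∃ p', p'.Sublist p ∧ IsSimpleUPath src tgt a b p' := by
  induction hk : p.length using Nat.strong_induction_on generalizing a p with
  | _ k ih =>
    by_cases ha : a ∈ p.map (stepHead src tgt)
    · obtain ⟨p₁, p₂, rfl, hne, -, h₂⟩ := hp.exists_split ha
      have hlen := List.length_pos_of_ne_nil hne
      rw [List.length_append] at hk
      obtain ⟨p', hs, h'⟩ := ih p₂.length (by omega) h₂ rfl
      exact ⟨p', hs.trans (List.sublist_append_right _ _), h'⟩
    · cases p with
      | nil => exact ⟨[], List.Sublist.refl _, hp, by simp⟩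
      | cons st p =>
        obtain ⟨rfl, h⟩ := uWalk_cons_iff.1 hp
        obtain ⟨p', hs, h', hn⟩ := ih p.length (by simp at hk; omega) h rfl
        have hs' := hs.cons_cons st
        exact ⟨st :: p', hs', h'.cons st,
          List.nodup_cons.2 ⟨fun hm => ha ((hs'.map _).subset hm), hn⟩⟩

/-- Without flow-carrying closed walks, every flow-carrying walk is simple. -/
theorem UWalk.isSimple_of_acyclic {x : Fin m → ℝ}
    (hac : ¬ ∃ (v : Fin n) (p : List (Fin m × Bool)),
      p ≠ [] ∧ UWalk src tgt v v p ∧ UFlowCarrying x p)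
    {a b : Fin n} {p : List (Fin m × Bool)} (hp : UWalk src tgt a b p)
    (hx : UFlowCarrying x p) : IsSimpleUPath src tgt a b p := by
  refine ⟨hp, ?_⟩
  induction p generalizing a with
  | nil => simp
  | cons st p ih =>
    refine List.nodup_cons.2 ⟨fun hm => ?_, ?_⟩
    · obtain ⟨p₁, p₂, h, hne, h₁, -⟩ := hp.exists_split hm
      exact hac ⟨a, p₁, hne, h₁, fun st' h' => hx st' (h ▸ List.mem_append_left _ h')⟩
    · exact ih (uWalk_cons_iff.1 hp).2 fun st' h' => hx st' (List.mem_cons_of_mem _ h')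

theorem upathCost_le_of_sublist {f : Fin m → ℝ} {p p' : List (Fin m × Bool)}
    (hs : p'.Sublist p) (hf : ∀ st ∈ p, 0 ≤ stepVal f st) :
    upathCost f p' ≤ upathCost f p := by
  induction hs with
  | slnil => exact le_rfl
  | cons st _ ih =>
    rw [upathCost_cons]
    have := ih fun st' h' => hf st' (List.mem_cons_of_mem _ h')
    have := hf st List.mem_cons_self
    linarith
  | cons_cons st _ ih =>
    rw [upathCost_cons, upathCost_cons]
    have := ih fun st' h' => hf st' (List.mem_cons_of_mem _ h')
    linarith

theorem upathCost_nonneg {f : Fin m → ℝ} {p : List (Fin m × Bool)}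
    (hf : ∀ st ∈ p, 0 ≤ stepVal f st) : 0 ≤ upathCost f p :=
  upathCost_le_of_sublist (List.nil_sublist p) hf

/-- If `f` is the coboundary of a potential, path costs are potential differences. -/
theorem UWalk.cost_eq_sub {f : Fin m → ℝ} {π : Fin n → ℝ}
    (hπ : ∀ e, π (tgt e) - π (src e) = f e) {a b : Fin n} {p : List (Fin m × Bool)}
    (hp : UWalk src tgt a b p) : upathCost f p = π b - π a := by
  induction hp with
  | nil v => simp [upathCost_nil]
  | consF e _ ih =>
    rw [upathCost_cons, ih, stepVal, if_pos rfl, ← hπ e]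
    ring
  | consB e _ ih =>
    rw [upathCost_cons, ih, stepVal, if_neg (by simp), ← hπ e]
    ring

/-- A vertex set that no flow leaves and whose total excess is nonpositive is not entered by
any flow. -/
theorem tail_mem_of_closed {x : Fin m → ℝ} {S : Set (Fin n)}
    {Γ : Matrix (Fin n) (Fin m) ℝ}
    (hsl : ∀ e, src e ≠ tgt e)
    (hΓ : ∀ v e, Γ v e = if v = tgt e then 1 else if v = src e then -1 else 0)
    (hcl : ∀ st, 0 < stepVal x st → stepTail src tgt st ∈ S → stepHead src tgt st ∈ S)
    (hS : ∀ v ∈ S, (Γ *ᵥ x) v ≤ 0)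
    (st : Fin m × Bool) (hst : 0 < stepVal x st) (hh : stepHead src tgt st ∈ S) :
    stepTail src tgt st ∈ S := by
  classical
  have hsum : ∑ v ∈ Finset.univ.filter (· ∈ S), (Γ *ᵥ x) v =
      ∑ e, ((if tgt e ∈ S then 1 else 0) - (if src e ∈ S then 1 else 0)) * x e := by
    simp only [Matrix.mulVec, dotProduct]
    rw [Finset.sum_comm]
    refine Finset.sum_congr rfl fun e _ => ?_
    rw [← Finset.sum_mul]
    congr 1
    have hΓ' : ∀ v, Γ v e = (if v = tgt e then 1 else 0) - (if v = src e then 1 else 0) := by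
      intro v
      rw [hΓ]
      by_cases h : v = tgt e
      · have : v ≠ src e := fun h' => hsl e (h'.symm.trans h)
        simp [h, (hsl e).symm]
      · by_cases h' : v = src e <;> simp [h, h', hsl e]
    simp only [hΓ', Finset.sum_sub_distrib]
    congr 1 <;> simp [Finset.sum_ite_eq']
  have hterm : ∀ e, 0 ≤
      (((if tgt e ∈ S then 1 else 0) - (if src e ∈ S then 1 else 0)) * x e : ℝ) := by
    intro e
    have hF := hcl (e, true)
    have hB := hcl (e, false)
    simp only [stepVal, stepTail, stepHead] at hF hB
    by_cases ht : tgt e ∈ S <;> by_cases hs : src e ∈ S <;> simp [ht, hs] at hF hB ⊢ <;>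
      assumption
  have hzero := (Finset.sum_eq_zero_iff_of_nonneg fun e _ => hterm e).1
    (le_antisymm (hsum ▸ Finset.sum_nonpos fun v hv => hS v (Finset.mem_filter.1 hv).2)
      (Finset.sum_nonneg fun e _ => hterm e)) st.1 (Finset.mem_univ _)
  by_contra hn
  obtain ⟨e, b⟩ := st
  cases b <;> simp [stepVal, stepTail, stepHead] at hst hh hn hzero <;>
    simp [hh, hn] at hzero <;> linarith

/-- In an acyclic flow, the head of every flow-carrying step is joined by a flow-carrying walk
to the only vertex `t` that may have positive excess. -/
theorem exists_flow_walk_to {x : Fin m → ℝ} {Γ : Matrix (Fin n) (Fin m) ℝ} {t : Fin n}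
    (hsl : ∀ e, src e ≠ tgt e)
    (hΓ : ∀ v e, Γ v e = if v = tgt e then 1 else if v = src e then -1 else 0)
    (hac : ¬ ∃ (v : Fin n) (p : List (Fin m × Bool)),
      p ≠ [] ∧ UWalk src tgt v v p ∧ UFlowCarrying x p)
    (ht : ∀ v, v ≠ t → (Γ *ᵥ x) v ≤ 0)
    (st : Fin m × Bool) (hst : 0 < stepVal x st) :
    ∃ p, UWalk src tgt (stepHead src tgt st) t p ∧ UFlowCarrying x p := by
  by_contra hno
  obtain ⟨p, hp, hx⟩ := tail_mem_of_closed (x := x)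
    (S := {v | ∃ p, UWalk src tgt (stepHead src tgt st) v p ∧ UFlowCarrying x p}) hsl hΓ
    (by
      rintro st' h' ⟨p, hp, hx⟩
      refine ⟨p ++ [st'], hp.append (UWalk.single st'), uFlowCarrying_iff.2 fun st'' h'' => ?_⟩
      rcases List.mem_append.1 h'' with h | h
      · exact uFlowCarrying_iff.1 hx _ h
      · rwa [List.mem_singleton.1 h])
    (by
      rintro v hv
      refine ht v ?_
      rintro rfl
      exact hno hv)
    st hst ⟨[], UWalk.nil _, by simp [UFlowCarrying]⟩
  refine hac ⟨_, st :: p, by simp, hp.cons st, uFlowCarrying_iff.2 fun st' h' => ?_⟩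
  rcases List.mem_cons.1 h' with rfl | h
  · exact hst
  · exact uFlowCarrying_iff.1 hx _ h

/-- In an acyclic flow, the tail of every flow-carrying step is reached by a flow-carrying walk
from the only vertex `s` that may have negative excess. -/
theorem exists_flow_walk_from {x : Fin m → ℝ} {Γ : Matrix (Fin n) (Fin m) ℝ} {s : Fin n}
    (hsl : ∀ e, src e ≠ tgt e)
    (hΓ : ∀ v e, Γ v e = if v = tgt e then 1 else if v = src e then -1 else 0)
    (hac : ¬ ∃ (v : Fin n) (p : List (Fin m × Bool)),
      p ≠ [] ∧ UWalk src tgt v v p ∧ UFlowCarrying x p)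
    (hs : ∀ v, v ≠ s → 0 ≤ (Γ *ᵥ x) v)
    (st : Fin m × Bool) (hst : 0 < stepVal x st) :
    ∃ p, UWalk src tgt s (stepTail src tgt st) p ∧ UFlowCarrying x p := by
  have hval : ∀ (e : Fin m) (b : Bool), stepVal (-x) (e, b) = stepVal x (e, !b) := by
    intro e b
    cases b <;> simp [stepVal]
  have htail : ∀ (e : Fin m) (b : Bool), stepTail src tgt (e, b) = stepHead src tgt (e, !b) := by
    intro e b
    cases b <;> simp [stepTail, stepHead]
  have hhead : ∀ (e : Fin m) (b : Bool), stepHead src tgt (e, b) = stepTail src tgt (e, !b) := by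
    intro e b
    cases b <;> simp [stepTail, stepHead]
  by_contra hno
  obtain ⟨p, hp, hx⟩ := tail_mem_of_closed (x := -x) (src := src) (tgt := tgt)
    (S := {v | ∃ p, UWalk src tgt v (stepTail src tgt st) p ∧ UFlowCarrying x p}) hsl hΓ
    (by
      rintro ⟨e, b⟩ h' ⟨p, hp, hx⟩
      rw [hval] at h'
      rw [htail] at hp
      refine ⟨(e, !b) :: p, hhead e b ▸ hp.cons _, uFlowCarrying_iff.2 fun st'' h'' => ?_⟩
      rcases List.mem_cons.1 h'' with rfl | h
      · exact h'
      · exact uFlowCarrying_iff.1 hx _ h)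
    (by
      rintro v hv
      rw [Matrix.mulVec_neg, Pi.neg_apply, neg_nonpos]
      refine hs v ?_
      rintro rfl
      exact hno hv)
    (st.1, !st.2) (by rw [hval, Bool.not_not]; exact hst)
    ⟨[], by rw [hhead, Bool.not_not]; exact UWalk.nil _, by simp [UFlowCarrying]⟩
  rw [htail, Bool.not_not] at hp
  refine hac ⟨_, st :: p, by simp, hp.cons st, uFlowCarrying_iff.2 fun st' h' => ?_⟩
  rcases List.mem_cons.1 h' with rfl | h
  · exact hst
  · exact uFlowCarrying_iff.1 hx _ h

/-- The costs of all walks from `s` to `v` none of whose steps has negative cost. -/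
def walkCosts (src tgt : Fin m → Fin n) (c : Fin m → ℝ) (s v : Fin n) : Set ℝ :=
  {r | ∃ p, UWalk src tgt s v p ∧ (∀ st ∈ p, 0 ≤ stepVal c st) ∧ upathCost c p = r}

theorem bddBelow_walkCosts (c : Fin m → ℝ) (s v : Fin n) :
    BddBelow (walkCosts src tgt c s v) := by
  refine ⟨0, ?_⟩
  rintro r ⟨p, -, hp, rfl⟩
  exact upathCost_nonneg hp

theorem walkCosts_add_mem {c : Fin m → ℝ} {s v w : Fin n} {r r' : ℝ}
    (h : r ∈ walkCosts src tgt c s v) (h' : r' ∈ walkCosts src tgt c v w) :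
    r + r' ∈ walkCosts src tgt c s w := by
  obtain ⟨p, hp, hc, rfl⟩ := h
  obtain ⟨p', hp', hc', rfl⟩ := h'
  refine ⟨p ++ p', hp.append hp', fun st hst => ?_, upathCost_append c p p'⟩
  rcases List.mem_append.1 hst with h | h
  exacts [hc _ h, hc' _ h]

theorem stepVal_mem_walkCosts {c : Fin m → ℝ} {st : Fin m × Bool} (h : 0 ≤ stepVal c st) :
    stepVal c st ∈ walkCosts src tgt c (stepTail src tgt st) (stepHead src tgt st) :=
  ⟨[st], UWalk.single st, by simpa using h, by simp [upathCost_cons, upathCost_nil]⟩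

theorem sInf_walkCosts_le {c : Fin m → ℝ} {s v w : Fin n} {r : ℝ}
    (hne : (walkCosts src tgt c s v).Nonempty) (h : r ∈ walkCosts src tgt c v w) :
    sInf (walkCosts src tgt c s w) ≤ sInf (walkCosts src tgt c s v) + r := by
  rw [← sub_le_iff_le_add]
  refine le_csInf hne fun r' hr' => ?_
  rw [sub_le_iff_le_add]
  exact csInf_le (bddBelow_walkCosts c s w) (walkCosts_add_mem hr' h)

theorem walkCosts_eq_of_cost_eq_zero {c : Fin m → ℝ} {e : Fin m} (h : c e = 0) (s : Fin n) :
    walkCosts src tgt c s (tgt e) = walkCosts src tgt c s (src e) := by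
  have hF := stepVal_mem_walkCosts (src := src) (tgt := tgt) (c := c) (st := (e, true))
    (by simp [stepVal, h])
  have hB := stepVal_mem_walkCosts (src := src) (tgt := tgt) (c := c) (st := (e, false))
    (by simp [stepVal, h])
  simp [stepVal, stepTail, stepHead, h] at hF hB
  ext r
  exact ⟨fun hr => by simpa using walkCosts_add_mem hr hB,
    fun hr => by simpa using walkCosts_add_mem hr hF⟩

/-- On a flow-carrying step, shortest walk lengths of an equilibrium grow by the step cost. -/
theorem sInf_walkCosts_step {c x : Fin m → ℝ} {s t : Fin n}
    (hcx : ∀ st, 0 < stepVal x st → 0 ≤ stepVal c st)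
    (hac : ¬ ∃ (v : Fin n) (p : List (Fin m × Bool)),
      p ≠ [] ∧ UWalk src tgt v v p ∧ UFlowCarrying x p)
    (hmin : ∀ P Q, IsSimpleUPath src tgt s t P → IsSimpleUPath src tgt s t Q →
      UFlowCarrying x P → upathCost c P ≤ upathCost c Q)
    {st : Fin m × Bool} (hst : 0 < stepVal x st) {p₁ p₂ : List (Fin m × Bool)}
    (h₁ : UWalk src tgt s (stepTail src tgt st) p₁) (hx₁ : UFlowCarrying x p₁)
    (h₂ : UWalk src tgt (stepHead src tgt st) t p₂) (hx₂ : UFlowCarrying x p₂) :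
    sInf (walkCosts src tgt c s (stepHead src tgt st)) =
      sInf (walkCosts src tgt c s (stepTail src tgt st)) + stepVal c st := by
  rw [uFlowCarrying_iff] at hx₁ hx₂
  have m₁ : upathCost c p₁ ∈ walkCosts src tgt c s (stepTail src tgt st) :=
    ⟨p₁, h₁, fun st' h => hcx _ (hx₁ _ h), rfl⟩
  have m₂ : upathCost c p₂ ∈ walkCosts src tgt c (stepHead src tgt st) t :=
    ⟨p₂, h₂, fun st' h => hcx _ (hx₂ _ h), rfl⟩
  have m := stepVal_mem_walkCosts (src := src) (tgt := tgt) (hcx st hst)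
  have mh := walkCosts_add_mem m₁ m
  have hP : UFlowCarrying x (p₁ ++ st :: p₂) := by
    refine uFlowCarrying_iff.2 fun st' h' => ?_
    rcases List.mem_append.1 h' with h | h
    · exact hx₁ _ h
    · rcases List.mem_cons.1 h with rfl | h
      exacts [hst, hx₂ _ h]
  have hsP := UWalk.isSimple_of_acyclic hac (h₁.append (h₂.cons st)) hP
  have hlow : upathCost c (p₁ ++ st :: p₂) ≤ sInf (walkCosts src tgt c s t) := by
    refine le_csInf ⟨_, walkCosts_add_mem mh m₂⟩ ?_
    rintro r ⟨Q, hQ, hcQ, rfl⟩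
    obtain ⟨Q', hsub, hQ'⟩ := hQ.exists_simple
    exact (hmin _ _ hsP hQ' hP).trans (upathCost_le_of_sublist hsub hcQ)
  rw [upathCost_append, upathCost_cons] at hlow
  have i₁ := csInf_le (bddBelow_walkCosts c s _) m₁
  have i := sInf_walkCosts_le ⟨_, m₁⟩ m
  have i₂ := sInf_walkCosts_le ⟨_, mh⟩ m₂
  linarith

end UWalk

/-- In an undirected single-commodity network with continuous cost functions
that are positive for positive flow and negative for negative flow, a feasible flow `x` is a
Wardrop equilibrium if and only if there is a potential `π` with
`π_w - π_v = l_e(x_e)` for every edge `e = (v,w)`. -/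
theorem undirected_wardrop_iff_potential
    (n m : ℕ) (src tgt : Fin m → Fin n)
    (hsl : ∀ e, src e ≠ tgt e)
    (hpar : ∀ e e', src e = src e' → tgt e = tgt e' → e = e')
    (Γ : Matrix (Fin n) (Fin m) ℝ)
    (hΓ : ∀ v e, Γ v e = if v = tgt e then 1 else if v = src e then -1 else 0)
    (l : Fin m → ℝ → ℝ)
    (hcont : ∀ e, Continuous (l e))
    (hpos : ∀ e ξ, 0 < ξ → 0 < l e ξ)
    (hneg : ∀ e ξ, ξ < 0 → l e ξ < 0)
    (s t : Fin n) (q : ℝ) (hq : 0 ≤ q)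
    (y : Fin n → ℝ)
    (hy : ∀ v, y v = (if v = t then q else 0) - (if v = s then q else 0))
    (x : Fin m → ℝ)
    (hfeas : Γ *ᵥ x = y) :
    IsUWardrop src tgt s t l x ↔
      ∃ π : Fin n → ℝ, ∀ e, π (tgt e) - π (src e) = l e (x e) := by
  have hzero : ∀ e, l e 0 = 0 := by
    intro e
    refine le_antisymm ?_ ?_
    · refine le_of_tendsto ((hcont e).continuousWithinAt (s := Set.Iio 0) (x := 0)) ?_
      filter_upwards [self_mem_nhdsWithin] with ξ hξ using (hneg e ξ hξ).le
    · refine ge_of_tendsto ((hcont e).continuousWithinAt (s := Set.Ioi 0) (x := 0)) ?_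
      filter_upwards [self_mem_nhdsWithin] with ξ hξ using (hpos e ξ hξ).le
  have hcx : ∀ st, 0 < stepVal x st → 0 < stepVal (fun e => l e (x e)) st := by
    rintro ⟨e, b⟩ h
    cases b
    · simp only [stepVal, Bool.false_eq_true, if_false, Left.neg_pos_iff] at h ⊢
      exact hneg e _ h
    · exact hpos e _ h
  constructor
  · rintro ⟨hac, hmin⟩
    have ht : ∀ v, v ≠ t → (Γ *ᵥ x) v ≤ 0 := by
      intro v hv
      rw [hfeas, hy, if_neg hv]
      split_ifs <;> linarith
    have hs : ∀ v, v ≠ s → 0 ≤ (Γ *ᵥ x) v := by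
      intro v hv
      rw [hfeas, hy, if_neg hv]
      split_ifs <;> linarith
    have key : ∀ st, 0 < stepVal x st →
        sInf (walkCosts src tgt (fun e => l e (x e)) s (stepHead src tgt st)) =
          sInf (walkCosts src tgt (fun e => l e (x e)) s (stepTail src tgt st)) +
            stepVal (fun e => l e (x e)) st := by
      intro st hst
      obtain ⟨p₁, h₁, hx₁⟩ := exists_flow_walk_from hsl hΓ hac hs st hst
      obtain ⟨p₂, h₂, hx₂⟩ := exists_flow_walk_to hsl hΓ hac ht st hst
      exact sInf_walkCosts_step (fun st' h => (hcx st' h).le) hac hmin hst h₁ hx₁ h₂ hx₂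
    refine ⟨fun v => sInf (walkCosts src tgt (fun e => l e (x e)) s v), fun e => ?_⟩
    rcases lt_trichotomy (x e) 0 with h | h | h
    · have := key (e, false) (by simpa [stepVal] using h)
      simp only [stepVal, stepTail, stepHead, Bool.false_eq_true, if_false] at this
      linarith
    · have hc : l e (x e) = 0 := by rw [h, hzero]
      beta_reduce
      rw [hc, walkCosts_eq_of_cost_eq_zero (c := fun e => l e (x e)) hc, sub_self]
    · have := key (e, true) (by simpa [stepVal] using h)
      simp only [stepVal, stepTail, stepHead, if_true] at this
      linarith
  · rintro ⟨π, hπ⟩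
    refine ⟨?_, fun P Q hP hQ _ => ?_⟩
    · rintro ⟨v, p, hne, hp, hx⟩
      have hcost := hp.cost_eq_sub (f := fun e => l e (x e)) hπ
      rw [uFlowCarrying_iff] at hx
      cases p with
      | nil => exact hne rfl
      | cons st p =>
        rw [upathCost_cons, sub_self] at hcost
        have h₁ := hcx st (hx st List.mem_cons_self)
        have h₂ := upathCost_nonneg (f := fun e => l e (x e)) (p := p)
          fun st' h => (hcx st' (hx st' (List.mem_cons_of_mem _ h))).le
        linarith
    · rw [hP.1.cost_eq_sub (f := fun e => l e (x e)) hπ,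
        hQ.1.cost_eq_sub (f := fun e => l e (x e)) hπ]
end

section
/- Let L̂₁ ∈ ℝ^{(n−1)×(n−1)} be symmetric positive definite, let γ̂ ∈ ℝ^{n−1}, let Δc ∈ ℝ, and suppose that L̂₂ := L̂₁ + Δc · γ̂ γ̂ᵀ is also symmetric positive definite. Fix Δŷ ∈ ℝ^{n−1} and define the direction vectors Δπ̂¹ := L̂₁⁻¹ Δŷ and Δπ̂² := L̂₂⁻¹ Δŷ. Then sgn(γ̂ᵀ Δπ̂¹) = sgn(γ̂ᵀ Δπ̂²); that is, γ̂ᵀ Δπ̂¹ and γ̂ᵀ Δπ̂² are both positive, both negative, or both zero. -/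
open Matrix

/-- The Sherman–Morrison relation between the pairings of `v` with the solutions of a linear system
and of its rank-one perturbation. -/
theorem dotProduct_inv_mulVec_eq_mul_of_rank_one_update
    {ι K : Type*} [Fintype ι] [DecidableEq ι] [Field K] {A : Matrix ι ι K} {v : ι → K} {c : K}
    (hA : IsUnit A.det) (hB : IsUnit (A + c • vecMulVec v v).det) (y : ι → K) :
    v ⬝ᵥ (A⁻¹ *ᵥ y) =
      (1 + c * (v ⬝ᵥ (A⁻¹ *ᵥ v))) * (v ⬝ᵥ ((A + c • vecMulVec v v)⁻¹ *ᵥ y)) := by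
  set p := (A + c • vecMulVec v v)⁻¹ *ᵥ y with hp
  have hy : y = A *ᵥ p + (c * (v ⬝ᵥ p)) • v := by
    have h : (A + c • vecMulVec v v) *ᵥ p = y := by
      rw [hp, mulVec_mulVec, mul_nonsing_inv _ hB, one_mulVec]
    rw [← h, add_mulVec, smul_mulVec, vecMulVec_mulVec, op_smul_eq_smul, smul_smul]
  rw [hy, mulVec_add, mulVec_smul, mulVec_mulVec, nonsing_inv_mul _ hA, one_mulVec,
    dotProduct_add, dotProduct_smul, smul_eq_mul]
  ring

/-- The Sherman–Morrison factor is positive when a positive definite matrix and its rank-one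
perturbation are both positive definite. -/
theorem one_add_mul_dotProduct_inv_mulVec_pos
    {ι : Type*} [Fintype ι] [DecidableEq ι] {A : Matrix ι ι ℝ} {v : ι → ℝ} {c : ℝ}
    (hA : A.PosDef) (hB : (A + c • vecMulVec v v).PosDef) :
    0 < 1 + c * (v ⬝ᵥ (A⁻¹ *ᵥ v)) := by
  rcases eq_or_ne v 0 with rfl | hv
  · simp
  have hs : 0 < v ⬝ᵥ (A⁻¹ *ᵥ v) := by simpa using hA.inv.dotProduct_mulVec_pos hv
  set w := A⁻¹ *ᵥ v with hw
  have hAw : A *ᵥ w = v := by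
    rw [hw, mulVec_mulVec, mul_nonsing_inv _ ((isUnit_iff_isUnit_det A).1 hA.isUnit), one_mulVec]
  have hw0 : w ≠ 0 := by
    intro h
    simp [h] at hs
  have h := hB.dotProduct_mulVec_pos hw0
  rw [star_trivial, add_mulVec, smul_mulVec, vecMulVec_mulVec, op_smul_eq_smul, hAw,
    dotProduct_add, dotProduct_smul, dotProduct_smul, dotProduct_comm w v, smul_eq_mul,
    smul_eq_mul] at h
  exact pos_of_mul_pos_right (a := v ⬝ᵥ w) (by linarith) hs.le

/-- Multiplication by a positive real preserves the sign. -/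
theorem real_sign_mul_of_pos_left {k : ℝ} (hk : 0 < k) (a : ℝ) :
    Real.sign (k * a) = Real.sign a := by
  have hneg : k * a < 0 ↔ a < 0 := smul_neg_iff_of_pos_left hk
  simp only [Real.sign, mul_pos_iff_of_pos_left hk, hneg]

/-- If `L₁` and `L₂ = L₁ + Δc γ γᵀ` are positive definite and
`Δπ¹ = L₁⁻¹ Δŷ`, `Δπ² = L₂⁻¹ Δŷ` are the direction vectors in two neighboring regions,
then `γᵀ Δπ¹` and `γᵀ Δπ²` have the same sign (both positive, both negative, or both zero). -/
theorem boundary_crossing_direction_sign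
    (n : ℕ) (L₁ : Matrix (Fin n) (Fin n) ℝ) (γ Δy : Fin n → ℝ) (Δc : ℝ)
    (hL₁ : L₁.PosDef)
    (hL₂ : (L₁ + Δc • Matrix.vecMulVec γ γ).PosDef) :
    Real.sign (γ ⬝ᵥ (L₁⁻¹ *ᵥ Δy)) =
      Real.sign (γ ⬝ᵥ ((L₁ + Δc • Matrix.vecMulVec γ γ)⁻¹ *ᵥ Δy)) := by
  rw [dotProduct_inv_mulVec_eq_mul_of_rank_one_update
    ((isUnit_iff_isUnit_det _).1 hL₁.isUnit) ((isUnit_iff_isUnit_det _).1 hL₂.isUnit) Δy]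
  exact real_sign_mul_of_pos_left (one_add_mul_dotProduct_inv_mulVec_pos hL₁ hL₂) _
end

section
/- Let v, w ∈ ℝⁿ and α₁, α₂ ∈ ℝ \ {0} with α₁ + α₂ ≠ 0. Let A ∈ ℝ^{n×n} be any matrix (possibly singular) with vᵀ A w ≠ −1/α₂ and vᵀ A w ≠ −1/(α₁ + α₂). Then ⊠^{α₂}_{v,w}(A) lies in the domain of ⊠^{α₁}_{v,w} (i.e. vᵀ ⊠^{α₂}_{v,w}(A) w ≠ −1/α₁), and ⊠^{α₁}_{v,w}( ⊠^{α₂}_{v,w}(A) ) = ⊠^{α₁+α₂}_{v,w}(A). -/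
open Matrix

/-- The Sherman–Morrison operator
`⊠^α_{v,w}(A) = (I − (α/(1 + α vᵀ A w)) A w vᵀ) A`, defined for matrices `A` with
`vᵀ A w ≠ −1/α`. -/
noncomputable def smOp {n : ℕ} (v w : Fin n → ℝ) (α : ℝ)
    (A : Matrix (Fin n) (Fin n) ℝ) : Matrix (Fin n) (Fin n) ℝ :=
  ((1 : Matrix (Fin n) (Fin n) ℝ) -
      (α / (1 + α * (v ⬝ᵥ (A *ᵥ w)))) • (A * Matrix.vecMulVec w v)) * A

/-- `⊠^α_{v,w}(A)` is a rank-one update of `A`. -/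
theorem smOp_eq_sub_smul_vecMulVec {n : ℕ} (v w : Fin n → ℝ) (α : ℝ)
    (A : Matrix (Fin n) (Fin n) ℝ) :
    smOp v w α A = A - (α / (1 + α * (v ⬝ᵥ (A *ᵥ w)))) • vecMulVec (A *ᵥ w) (v ᵥ* A) := by
  rw [smOp, Matrix.sub_mul, Matrix.one_mul, Matrix.smul_mul, Matrix.mul_vecMulVec,
    Matrix.vecMulVec_mul]

/-- On its domain, `⊠^α_{v,w}` scales the vector `A w` by `1 / (1 + α vᵀ A w)`. -/
theorem smOp_mulVec {n : ℕ} (v w : Fin n → ℝ) (α : ℝ) (A : Matrix (Fin n) (Fin n) ℝ)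
    (h : 1 + α * (v ⬝ᵥ (A *ᵥ w)) ≠ 0) :
    smOp v w α A *ᵥ w = (1 / (1 + α * (v ⬝ᵥ (A *ᵥ w)))) • (A *ᵥ w) := by
  rw [smOp_eq_sub_smul_vecMulVec, Matrix.sub_mulVec, Matrix.smul_mulVec,
    Matrix.vecMulVec_mulVec, ← Matrix.dotProduct_mulVec]
  ext i
  simp only [Pi.sub_apply, Pi.smul_apply, smul_eq_mul, MulOpposite.smul_eq_mul_unop,
    MulOpposite.unop_op]
  field_simp
  ring

/-- On its domain, `⊠^α_{v,w}` scales the row vector `vᵀ A` by `1 / (1 + α vᵀ A w)`. -/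
theorem vecMul_smOp {n : ℕ} (v w : Fin n → ℝ) (α : ℝ) (A : Matrix (Fin n) (Fin n) ℝ)
    (h : 1 + α * (v ⬝ᵥ (A *ᵥ w)) ≠ 0) :
    v ᵥ* smOp v w α A = (1 / (1 + α * (v ⬝ᵥ (A *ᵥ w)))) • (v ᵥ* A) := by
  rw [smOp_eq_sub_smul_vecMulVec, Matrix.vecMul_sub, Matrix.vecMul_smul,
    Matrix.vecMul_vecMulVec]
  ext i
  simp only [Pi.sub_apply, Pi.smul_apply, smul_eq_mul]
  field_simp
  ring

theorem one_add_mul_ne_zero_of_ne_neg_one_div {a s : ℝ} (ha : a ≠ 0) (h : s ≠ -1 / a) :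
    1 + a * s ≠ 0 := by
  contrapose! h
  rw [eq_div_iff ha]
  linarith

/-- For any (possibly singular) matrix `A` in the domains of
`⊠^{α₂}_{v,w}` and `⊠^{α₁+α₂}_{v,w}`, the matrix `⊠^{α₂}_{v,w}(A)` lies in the domain of
`⊠^{α₁}_{v,w}` and `⊠^{α₁}_{v,w}(⊠^{α₂}_{v,w}(A)) = ⊠^{α₁+α₂}_{v,w}(A)`. -/
theorem smOp_comp_eq_smOp_add
    (n : ℕ) (v w : Fin n → ℝ) (α₁ α₂ : ℝ)
    (hα₁ : α₁ ≠ 0) (hα₂ : α₂ ≠ 0) (hsum : α₁ + α₂ ≠ 0)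
    (A : Matrix (Fin n) (Fin n) ℝ)
    (h₂ : v ⬝ᵥ (A *ᵥ w) ≠ -1 / α₂)
    (h₁₂ : v ⬝ᵥ (A *ᵥ w) ≠ -1 / (α₁ + α₂)) :
    v ⬝ᵥ ((smOp v w α₂ A) *ᵥ w) ≠ -1 / α₁ ∧
    smOp v w α₁ (smOp v w α₂ A) = smOp v w (α₁ + α₂) A := by
  have hd₂ := one_add_mul_ne_zero_of_ne_neg_one_div hα₂ h₂
  have hd₁₂ := one_add_mul_ne_zero_of_ne_neg_one_div hsum h₁₂
  have hs : v ⬝ᵥ (smOp v w α₂ A *ᵥ w) =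
      (v ⬝ᵥ (A *ᵥ w)) / (1 + α₂ * (v ⬝ᵥ (A *ᵥ w))) := by
    rw [smOp_mulVec v w α₂ A hd₂, dotProduct_smul, smul_eq_mul, one_div_mul_eq_div]
  have hd₁ : 1 + α₁ * (v ⬝ᵥ (smOp v w α₂ A *ᵥ w)) =
      (1 + (α₁ + α₂) * (v ⬝ᵥ (A *ᵥ w))) / (1 + α₂ * (v ⬝ᵥ (A *ᵥ w))) := by
    rw [hs, eq_div_iff hd₂, add_mul, mul_assoc, div_mul_cancel₀ _ hd₂]
    ring
  refine ⟨fun h => div_ne_zero hd₁₂ hd₂ ?_, ?_⟩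
  · rw [← hd₁, h]
    field_simp
    ring
  · rw [smOp_eq_sub_smul_vecMulVec v w α₁, hd₁, smOp_mulVec v w α₂ A hd₂,
      vecMul_smOp v w α₂ A hd₂, smOp_eq_sub_smul_vecMulVec v w α₂,
      smOp_eq_sub_smul_vecMulVec v w (α₁ + α₂)]
    ext i j
    simp only [Matrix.sub_apply, Matrix.smul_apply, vecMulVec_apply, Pi.smul_apply, smul_eq_mul]
    generalize v ⬝ᵥ (A *ᵥ w) = s at hd₂ hd₁₂ ⊢
    generalize hd : 1 + α₂ * s = d at hd₂ ⊢
    generalize he : 1 + (α₁ + α₂) * s = e at hd₁₂ ⊢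
    field_simp
    rw [← hd, ← he]
    ring
end

section
/- Fix j ∈ ℕ, j ≥ 1, and consider the j-th nested Braess network B^(j) with single commodity from s = v₀ to t = v_{2j+1} and demand q. Then for every demand q ≥ 2·10^{j−1}, the flow x given by x_e = q/2 for e ∈ {(v₀, v₁), (v₀, v_{2j}), (v₁, v_{2j+1}), (v_{2j}, v_{2j+1})} and x_e = 0 for all other edges is a Wardrop equilibrium flow in B^(j), and the travel time from s to t (the common cost of the two flow-carrying paths) equals 10^{j−1} + q/2. -/
open BigOperators

namespace NestedBraess

/-- `(u, w)` is an edge of `E_j^(1) = {(v_i, v_{i+1}) : 0 ≤ i ≤ 2j, i ≠ j}`. -/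
def inE1 (j u w : ℕ) : Prop := w = u + 1 ∧ u ≤ 2 * j ∧ u ≠ j

/-- `(u, w)` is an edge of `E_j^(2) = {(v_i, v_{2j−i}) : 0 ≤ i ≤ j−1}`. -/
def inE2 (j u w : ℕ) : Prop := u ≤ j - 1 ∧ w = 2 * j - u

/-- `(u, w)` is an edge of `E_j^(3) = {(v_{i+1}, v_{2j+1−i}) : 0 ≤ i ≤ j−1}`. -/
def inE3 (j u w : ℕ) : Prop := 1 ≤ u ∧ u ≤ j ∧ w = 2 * j + 2 - u

/-- `(u, w)` is an edge of the `j`-th nested Braess graph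
`E_j = E_j^(1) ∪ E_j^(2) ∪ E_j^(3) ∪ {(v_j, v_{j+1})}`. -/
def isEdge (j u w : ℕ) : Prop := inE1 j u w ∨ inE2 j u w ∨ inE3 j u w ∨ (u = j ∧ w = j + 1)

instance (j u w : ℕ) : Decidable (inE1 j u w) := by unfold inE1; infer_instance
instance (j u w : ℕ) : Decidable (inE2 j u w) := by unfold inE2; infer_instance
instance (j u w : ℕ) : Decidable (inE3 j u w) := by unfold inE3; infer_instance
instance (j u w : ℕ) : Decidable (isEdge j u w) := by unfold isEdge; infer_instance

/-- Slope of the affine cost of edge `(u,w)`: `1` on `E_j^(1)` and `0` otherwise. -/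
noncomputable def aCoef (j u w : ℕ) : ℝ := if inE1 j u w then 1 else 0

/-- Offset of the affine cost of edge `(u,w)`: `10^{j−1−i}` for the edge
`(v_i, v_{2j−i}) ∈ E_j^(2)` (where `i = u`), `10^{j−1−i}` for the edge
`(v_{i+1}, v_{2j+1−i}) ∈ E_j^(3)` (where `i = u − 1`), and `0` otherwise. -/
noncomputable def bCoef (j u w : ℕ) : ℝ :=
  if inE2 j u w then (10 : ℝ) ^ (j - 1 - u)
  else if inE3 j u w then (10 : ℝ) ^ (j - 1 - (u - 1))
  else 0

/-- The affine cost `l_e(ξ) = a_e ξ + b_e` of edge `(u,w)`. -/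
noncomputable def cost (j u w : ℕ) (ξ : ℝ) : ℝ := aCoef j u w * ξ + bCoef j u w

/-- A flow `x` is feasible for demand `q` from `s = v₀` to `t = v_{2j+1}`: it is nonnegative,
supported on the edges, conserved at the internal vertices, and has net outflow `q` at `s`
and net inflow `q` at `t`. -/
def IsFeasible (j : ℕ) (q : ℝ) (x : ℕ → ℕ → ℝ) : Prop :=
  (∀ u w, 0 ≤ x u w) ∧
  (∀ u w, ¬ isEdge j u w → x u w = 0) ∧
  (∀ v, v ≠ 0 → v ≠ 2 * j + 1 →
    (∑ u ∈ Finset.range (2 * j + 2), x u v) = ∑ w ∈ Finset.range (2 * j + 2), x v w) ∧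
  ((∑ w ∈ Finset.range (2 * j + 2), x 0 w) - (∑ u ∈ Finset.range (2 * j + 2), x u 0) = q) ∧
  ((∑ u ∈ Finset.range (2 * j + 2), x u (2 * j + 1)) -
      (∑ w ∈ Finset.range (2 * j + 2), x (2 * j + 1) w) = q)

/-- A simple directed path from `a` to `b`, given as its (repetition-free) list of vertices. -/
def IsSimplePath (j : ℕ) (a b : ℕ) (vs : List ℕ) : Prop :=
  vs ≠ [] ∧ vs.head? = some a ∧ vs.getLast? = some b ∧
    vs.Chain' (isEdge j) ∧ vs.Nodup

/-- The cost of a path (list of vertices) with respect to the flow `x`. -/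
noncomputable def pathCost (j : ℕ) (x : ℕ → ℕ → ℝ) (vs : List ℕ) : ℝ :=
  ((vs.zip vs.tail).map (fun p => cost j p.1 p.2 (x p.1 p.2))).sum

/-- A path (list of vertices) is flow-carrying if `x > 0` on each of its edges. -/
def FlowCarrying (x : ℕ → ℕ → ℝ) (vs : List ℕ) : Prop :=
  ∀ p ∈ vs.zip vs.tail, 0 < x p.1 p.2

/-- A flow `x` is a Wardrop equilibrium in the `j`-th nested Braess network: no directed
cycle is flow-carrying, and every flow-carrying simple `s`-`t` path is at most as long as
any other simple `s`-`t` path. -/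
def IsWardrop (j : ℕ) (x : ℕ → ℕ → ℝ) : Prop :=
  (¬ ∃ vs : List ℕ, 2 ≤ vs.length ∧ vs.head? = vs.getLast? ∧ vs.Chain' (isEdge j) ∧
      FlowCarrying x vs) ∧
  (∀ P Q : List ℕ, IsSimplePath j 0 (2 * j + 1) P → IsSimplePath j 0 (2 * j + 1) Q →
    FlowCarrying x P → pathCost j x P ≤ pathCost j x Q)

/-- The flow routing `q/2` along each of the two outer paths
`(v₀, v₁), (v₁, v_{2j+1})` and `(v₀, v_{2j}), (v_{2j}, v_{2j+1})`, and nothing elsewhere. -/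
noncomputable def outerFlow (j : ℕ) (q : ℝ) (u w : ℕ) : ℝ :=
  if (u = 0 ∧ w = 1) ∨ (u = 0 ∧ w = 2 * j) ∨ (u = 1 ∧ w = 2 * j + 1) ∨
      (u = 2 * j ∧ w = 2 * j + 1) then q / 2 else 0

/-- Consecutive differences of `φ` along a list telescope. -/
theorem sum_zip_tail_sub (φ : ℕ → ℝ) {a b : ℕ} {l : List ℕ} (ha : l.head? = some a)
    (hb : l.getLast? = some b) :
    ((l.zip l.tail).map fun p => φ p.2 - φ p.1).sum = φ b - φ a := by
  induction l generalizing a with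
  | nil => simp at ha
  | cons c l ih =>
    obtain rfl : c = a := by simpa using ha
    cases l with
    | nil =>
      obtain rfl : c = b := by simpa using hb
      simp
    | cons d l =>
      have h := ih (a := d) rfl (by simpa using hb)
      simp only [List.tail_cons, List.zip_cons_cons, List.map_cons, List.sum_cons] at h ⊢
      rw [h]
      ring

theorem forall_mem_zip_tail_of_isChain {R : ℕ → ℕ → Prop} {l : List ℕ} (hl : l.IsChain R) :
    ∀ p ∈ l.zip l.tail, R p.1 p.2 := by
  induction hl with
  | nil => simp
  | singleton => simp
  | cons_cons h _ ih =>
    intro p hp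
    rw [List.tail_cons, List.zip_cons_cons, List.mem_cons] at hp
    rcases hp with rfl | hp
    · exact h
    · exact ih p hp

theorem isEdge.lt {j u w : ℕ} (hj : 1 ≤ j) (h : isEdge j u w) : u < w := by
  simp only [isEdge, inE1, inE2, inE3] at h
  omega

theorem outerFlow_eq_sum {j : ℕ} (hj : 1 ≤ j) (q : ℝ) (u w : ℕ) :
    outerFlow j q u w =
      (if u = 0 then if w = 1 then q / 2 else 0 else 0) +
      (if u = 0 then if w = 2 * j then q / 2 else 0 else 0) +
      (if u = 1 then if w = 2 * j + 1 then q / 2 else 0 else 0) +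
      (if u = 2 * j then if w = 2 * j + 1 then q / 2 else 0 else 0) := by
  simp only [outerFlow]
  split_ifs <;> first | omega | simp

theorem sum_outerFlow_out {j : ℕ} (hj : 1 ≤ j) (q : ℝ) (v : ℕ) :
    ∑ w ∈ Finset.range (2 * j + 2), outerFlow j q v w =
      (if v = 0 then q else 0) + (if v = 1 then q / 2 else 0) +
        (if v = 2 * j then q / 2 else 0) := by
  simp only [outerFlow_eq_sum hj, Finset.sum_add_distrib]
  split_ifs <;> simp

theorem sum_outerFlow_in {j : ℕ} (hj : 1 ≤ j) (q : ℝ) (v : ℕ) :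
    ∑ u ∈ Finset.range (2 * j + 2), outerFlow j q u v =
      (if v = 1 then q / 2 else 0) + (if v = 2 * j then q / 2 else 0) +
        (if v = 2 * j + 1 then q else 0) := by
  simp only [outerFlow_eq_sum hj, Finset.sum_add_distrib, Finset.sum_ite_eq', Finset.mem_range]
  split_ifs <;> first | omega | ring

theorem isFeasible_outerFlow {j : ℕ} (hj : 1 ≤ j) {q : ℝ} (hq : 0 ≤ q) :
    IsFeasible j q (outerFlow j q) := by
  refine ⟨fun u w => ?_, fun u w h => if_neg fun h' => h ?_, fun v h0 ht => ?_, ?_, ?_⟩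
  · unfold outerFlow
    split_ifs <;> positivity
  · simp only [isEdge, inE1, inE2, inE3]
    omega
  · simp [sum_outerFlow_in hj, sum_outerFlow_out hj, h0, ht]
  · simp [sum_outerFlow_in hj, sum_outerFlow_out hj, show j ≠ 0 by omega]
  · simp [sum_outerFlow_in hj, sum_outerFlow_out hj, show j ≠ 0 by omega]

/-- A vertex potential dominated by the edge costs under the outer flow and tight on its
support. -/
noncomputable def potential (j : ℕ) (q : ℝ) (v : ℕ) : ℝ :=
  if v = 0 then 0
  else if v = 1 then q / 2
  else if v = 2 * j + 1 then (10 : ℝ) ^ (j - 1) + q / 2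
  else (10 : ℝ) ^ (j - 1)

theorem cost_outerFlow_of_pos {j : ℕ} (hj : 1 ≤ j) {q : ℝ} {u w : ℕ}
    (h : 0 < outerFlow j q u w) :
    cost j u w (outerFlow j q u w) = potential j q w - potential j q u := by
  have hs : (u = 0 ∧ w = 1) ∨ (u = 0 ∧ w = 2 * j) ∨ (u = 1 ∧ w = 2 * j + 1) ∨
      (u = 2 * j ∧ w = 2 * j + 1) := by
    by_contra hs
    simp [outerFlow, hs] at h
  have hx : outerFlow j q u w = q / 2 := if_pos hs
  rw [hx]
  simp only [cost, aCoef, bCoef, potential]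
  rcases hs with ⟨hu, hw⟩ | ⟨hu, hw⟩ | ⟨hu, hw⟩ | ⟨hu, hw⟩ <;>
    split_ifs <;> simp only [inE1, inE2, inE3] at * <;> first | omega | simp [hu]

theorem potential_sub_le_cost {j : ℕ} (hj : 1 ≤ j) {q : ℝ} (hq : 2 * (10 : ℝ) ^ (j - 1) ≤ q)
    {u w : ℕ} (h : isEdge j u w) :
    potential j q w - potential j q u ≤ cost j u w (outerFlow j q u w) := by
  have hq0 : 0 < q := lt_of_lt_of_le (by positivity) hq
  rcases ((isFeasible_outerFlow hj hq0.le).1 u w).lt_or_eq with hx | hx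
  · exact (cost_outerFlow_of_pos hj hx).ge
  have hs : ¬ ((u = 0 ∧ w = 1) ∨ (u = 0 ∧ w = 2 * j) ∨ (u = 1 ∧ w = 2 * j + 1) ∨
      (u = 2 * j ∧ w = 2 * j + 1)) := fun hs => by
    rw [outerFlow, if_pos hs] at hx
    linarith
  have hc : 0 ≤ cost j u w (outerFlow j q u w) := by
    rw [← hx]
    simp only [cost, bCoef, mul_zero, zero_add]
    split_ifs <;> positivity
  refine le_trans ?_ hc
  simp only [isEdge, inE1, inE2, inE3] at h
  simp only [potential]
  split_ifs <;> first | omega | linarith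

/-- In the `j`-th nested Braess network (`j ≥ 1`), for every demand
`q ≥ 2·10^{j−1}` the flow routing `q/2` along each of the two outer paths is a feasible
Wardrop equilibrium, and the travel time from `s` to `t` — the common cost of the
flow-carrying simple `s`-`t` paths — equals `10^{j−1} + q/2`. -/
theorem braess_outer_flow_is_wardrop
    (j : ℕ) (hj : 1 ≤ j) (q : ℝ) (hq : 2 * (10 : ℝ) ^ (j - 1) ≤ q) :
    IsFeasible j q (outerFlow j q) ∧
    IsWardrop j (outerFlow j q) ∧
    ∀ P : List ℕ, IsSimplePath j 0 (2 * j + 1) P → FlowCarrying (outerFlow j q) P →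
      pathCost j (outerFlow j q) P = (10 : ℝ) ^ (j - 1) + q / 2 := by
  have hq0 : 0 < q := lt_of_lt_of_le (by positivity) hq
  have hφ : potential j q (2 * j + 1) - potential j q 0 = (10 : ℝ) ^ (j - 1) + q / 2 := by
    have : j ≠ 0 := by omega
    simp [potential, this]
  have hcarry : ∀ P : List ℕ, IsSimplePath j 0 (2 * j + 1) P →
      FlowCarrying (outerFlow j q) P →
      pathCost j (outerFlow j q) P = (10 : ℝ) ^ (j - 1) + q / 2 := by
    rintro P ⟨-, hs, ht, -, -⟩ hP
    rw [← hφ, ← sum_zip_tail_sub (potential j q) hs ht, pathCost]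
    exact congrArg List.sum (List.map_congr_left fun p hp => cost_outerFlow_of_pos hj (hP p hp))
  refine ⟨isFeasible_outerFlow hj hq0.le, ⟨?_, ?_⟩, hcarry⟩
  · rintro ⟨vs, hlen, hclosed, hchain, -⟩
    have hlt := (List.IsChain.imp (fun _ _ h => isEdge.lt hj h) hchain).pairwise
    match vs, hlen with
    | a :: b :: l, _ =>
      have ha : a = (b :: l).getLast (by simp) := by
        simpa [List.getLast?_eq_some_getLast] using hclosed
      have := (List.pairwise_cons.1 hlt).1 _ (List.getLast_mem (l := b :: l) (by simp))
      omega
  · rintro P Q hP ⟨-, hs, ht, hchain, -⟩ hPx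
    rw [hcarry P hP hPx, ← hφ, ← sum_zip_tail_sub (potential j q) hs ht, pathCost]
    exact List.sum_le_sum fun p hp =>
      potential_sub_le_cost hj hq (forall_mem_zip_tail_of_isChain hchain p hp)

end NestedBraess
end
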